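/- (Prediction with i.i.d. side information against an adaptive Nature.) Let (X, Σ) be a measurable space, P a probability measure on X, and let φ : X^n × {−1,+1}^n → ℝ be bounded measurable and stable in its second argument, i.e. |φ(x; y_{1:t−1},+1,y_{t+1:n}) − φ(x; y_{1:t−1},−1,y_{t+1:n})| ≤ 1/n for all x, t, y. Let x_1,…,x_n be i.i.d. from P, and let Nature choose each label y_t ∈ {−1,+1} as an arbitrary measurable function of the history (x_s, y_s, ŷ_s)_{s<t} and of x_t, where on round t the forecaster draws ŷ_t with mean q_t(x_{1:t}, y_{1:t−1}) ∈ [−1,1] using fresh independent randomness. Then E_{x∼P^n, ε} φ(x; ε) ≥ 1/2 (ε uniform on {−1,+1}^n, independent of x) if and only if there exists a strategy (q_t)_{t=1}^n such that for every such adaptive Nature, E[ (1/n) Σ_{t=1}^n 1{ŷ_t ≠ y_t} ] ≤ E[ φ(x_{1:n}; y_{1:n}) ]. -/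

import Mathlib

open Finset MeasureTheory

noncomputable section

/-- The real ±1 value of a Boolean bit (`true ↦ +1`, `false ↦ -1`). -/
def sgn (b : Bool) : ℝ := if b then 1 else -1

/-- The labels produced by the adaptive Nature `g`: given the realized side information `x` and
the realized predictions `yh`, the label at time `t` is
`y_t = g t (x_{<t}) (y_{<t}) (ŷ_{<t}) (x_t)`. -/
def labels {n : ℕ} {X : Type*}
    (g : (t : Fin n) → (Fin t.1 → X) → (Fin t.1 → Bool) → (Fin t.1 → Bool) → X → Bool)
    (x : Fin n → X) (yh : Fin n → Bool) : (t : Fin n) → Bool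
  | t =>
    g t (fun s => x ⟨s.1, s.2.trans t.2⟩)
      (fun s => labels g x yh ⟨s.1, s.2.trans t.2⟩)
      (fun s => yh ⟨s.1, s.2.trans t.2⟩)
      (x t)
  termination_by t => t.1

/-- The probability that the forecaster's fresh coins produce the prediction sequence `yh`, when
round `t`'s prediction has mean `q t (x_{1:t}) (y_{1:t−1})` and the labels are produced by the
adaptive Nature `g`. -/
def coinWeight {n : ℕ} {X : Type*}
    (q : (t : Fin n) → (Fin (t.1 + 1) → X) → (Fin t.1 → Bool) → ℝ)
    (g : (t : Fin n) → (Fin t.1 → X) → (Fin t.1 → Bool) → (Fin t.1 → Bool) → X → Bool)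
    (x : Fin n → X) (yh : Fin n → Bool) : ℝ :=
  ∏ t : Fin n,
    (1 + sgn (yh t) *
        q t (fun s => x (Fin.castLE t.isLt s))
          (fun s => labels g x yh ⟨s.1, s.2.trans t.2⟩)) / 2

section helpers

/-- Splice two sequences at time `m`. -/
def spl {n : ℕ} {α : Type*} (m : ℕ) (a b : Fin n → α) : Fin n → α :=
  fun s => if s.1 < m then a s else b s

/-- `F` depends only on coordinates `< m`. -/
def Dep {n : ℕ} {α β : Type*} (m : ℕ) (F : (Fin n → α) → β) : Prop :=
  ∀ a b : Fin n → α, (∀ s : Fin n, s.1 < m → a s = b s) → F a = F b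

lemma sum_flip {n : ℕ} (t : Fin n) (f : (Fin n → Bool) → ℝ) :
    ∑ y, f y = ∑ y, f (Function.update y t (!y t)) := by
  have hinv : Function.Involutive (fun y : Fin n → Bool => Function.update y t (!y t)) := by
    intro y
    funext s
    by_cases hs : s = t
    · subst hs; simp
    · simp [hs]
  exact (Equiv.sum_comp hinv.toPerm f).symm

lemma sum_flip_avg {n : ℕ} (t : Fin n) (f : (Fin n → Bool) → ℝ) :
    ∑ y, f y = ∑ y, (f (Function.update y t true) + f (Function.update y t false)) / 2 := by
  have h := sum_flip t f
  have h2 : ∑ y, f y = ∑ y, (f y + f (Function.update y t (!y t))) / 2 := by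
    rw [← Finset.sum_div, Finset.sum_add_distrib, ← h]; ring
  rw [h2]
  refine Finset.sum_congr rfl fun y _ => ?_
  have hy : y = Function.update y t (y t) := by simp
  cases hb : y t
  · rw [hb] at hy; rw [← hy]; simp [add_comm]
  · rw [hb] at hy; rw [← hy]; simp

/-- Partial coin weight. -/
def Wm {n : ℕ} (r : Fin n → (Fin n → Bool) → ℝ) (m : ℕ) (yh : Fin n → Bool) : ℝ :=
  ∏ s : Fin n, (if s.1 < m then (1 + sgn (yh s) * r s yh) else 1) / 2

lemma Wm_succ {n : ℕ} (r : Fin n → (Fin n → Bool) → ℝ) (t : Fin n) (yh : Fin n → Bool) :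
    Wm r (t.1 + 1) yh = Wm r t.1 yh * (1 + sgn (yh t) * r t yh) := by
  have : (1 + sgn (yh t) * r t yh)
      = ∏ s : Fin n, if s = t then (1 + sgn (yh s) * r s yh) else 1 := by
    rw [Finset.prod_ite_eq' Finset.univ t]; simp
  rw [this]
  unfold Wm
  rw [← Finset.prod_mul_distrib]
  refine Finset.prod_congr rfl fun s _ => ?_
  by_cases h1 : s = t
  · subst h1; simp; ring
  · have h2 : s.1 ≠ t.1 := fun h => h1 (Fin.ext h)
    by_cases h3 : s.1 < t.1
    · simp [h1, h3, Nat.lt_succ_of_lt h3]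
    · have h4 : ¬ s.1 < t.1 + 1 := by omega
      simp [h1, h3, h4]

lemma Wm_dep {n : ℕ} (r : Fin n → (Fin n → Bool) → ℝ) (hr : ∀ s : Fin n, Dep s.1 (r s)) (m : ℕ) :
    Dep m (Wm r m) := by
  intro a b hab
  unfold Wm
  refine Finset.prod_congr rfl fun s _ => ?_
  by_cases hs : s.1 < m
  · simp only [hs, if_true]
    rw [hab s hs, hr s a b fun u hu => hab u (hu.trans hs)]
  · simp [hs]

lemma Wm_step {n : ℕ} (r : Fin n → (Fin n → Bool) → ℝ) (hr : ∀ s : Fin n, Dep s.1 (r s))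
    (t : Fin n) (F : (Fin n → Bool) → ℝ) (hF : Dep t.1 F) :
    ∑ yh, Wm r (t.1 + 1) yh * F yh = ∑ yh, Wm r t.1 yh * F yh := by
  rw [sum_flip_avg t]
  refine Finset.sum_congr rfl fun y _ => ?_
  have hu : ∀ b, ∀ s : Fin n, s.1 < t.1 → Function.update y t b s = y s := by
    intro b s hs
    have : s ≠ t := fun h => by subst h; omega
    simp [this]
  rw [Wm_succ, Wm_succ, hF _ y (hu true), hF _ y (hu false), Wm_dep r hr t.1 _ y (hu true),
    Wm_dep r hr t.1 _ y (hu false), hr t _ y (hu true), hr t _ y (hu false)]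
  simp [sgn]; ring

lemma Wm_reduce {n : ℕ} (r : Fin n → (Fin n → Bool) → ℝ) (hr : ∀ s : Fin n, Dep s.1 (r s))
    (m k : ℕ) (hk : m + k ≤ n) (F : (Fin n → Bool) → ℝ) (hF : Dep m F) :
    ∑ yh, Wm r (m + k) yh * F yh = ∑ yh, Wm r m yh * F yh := by
  induction k with
  | zero => rfl
  | succ k ih =>
    rw [← ih (by omega)]
    exact Wm_step r hr ⟨m + k, by omega⟩ F fun a b h => hF a b fun s hs => h s (by simp; omega)

lemma Wm_full {n : ℕ} (r : Fin n → (Fin n → Bool) → ℝ) (hr : ∀ s : Fin n, Dep s.1 (r s))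
    (m : ℕ) (hm : m ≤ n) (F : (Fin n → Bool) → ℝ) (hF : Dep m F) :
    ∑ yh, Wm r n yh * F yh = ∑ yh, Wm r m yh * F yh := by
  obtain ⟨k, rfl⟩ := Nat.exists_eq_add_of_le hm
  exact Wm_reduce r hr m k le_rfl F hF

lemma Wm_const {n : ℕ} (r : Fin n → (Fin n → Bool) → ℝ) (hr : ∀ s : Fin n, Dep s.1 (r s)) (c : ℝ) :
    ∑ yh, Wm r n yh * c = c := by
  rw [Wm_full r hr 0 (Nat.zero_le _) (fun _ => c) (fun _ _ _ => rfl)]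
  simp [Wm]

lemma Wm_mistake {n : ℕ} (r : Fin n → (Fin n → Bool) → ℝ) (hr : ∀ s : Fin n, Dep s.1 (r s))
    (t : Fin n) (Y : (Fin n → Bool) → Bool) (hY : Dep t.1 Y) :
    ∑ yh, Wm r n yh * (if yh t ≠ Y yh then (1 : ℝ) else 0)
      = 1 / 2 - (∑ yh, Wm r n yh * (sgn (Y yh) * r t yh)) / 2 := by
  have h1 : (1 : ℝ) / 2 - (∑ yh, Wm r n yh * (sgn (Y yh) * r t yh)) / 2
      = ∑ yh, Wm r n yh * ((1 - sgn (Y yh) * r t yh) / 2) := by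
    rw [← Wm_const r hr (1 / 2), Finset.sum_div, ← Finset.sum_sub_distrib]
    exact Finset.sum_congr rfl fun y _ => by ring
  rw [h1, Wm_full r hr (t.1 + 1) t.2 _ (fun a b h => by
      rw [h t (Nat.lt_succ_self _), hY a b fun s hs => h s (Nat.lt_succ_of_lt hs)]),
    Wm_full r hr (t.1 + 1) t.2 _ (fun a b h => by
      rw [hr t a b fun s hs => h s (Nat.lt_succ_of_lt hs),
        hY a b fun s hs => h s (Nat.lt_succ_of_lt hs)]),
    sum_flip_avg t, sum_flip_avg t (fun yh => Wm r (t.1 + 1) yh * ((1 - sgn (Y yh) * r t yh) / 2))]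
  refine Finset.sum_congr rfl fun y _ => ?_
  have hu : ∀ b, ∀ s : Fin n, s.1 < t.1 → Function.update y t b s = y s := by
    intro b s hs
    have : s ≠ t := fun h => by subst h; omega
    simp [this]
  simp only [Wm_succ, hY _ y (hu true), hY _ y (hu false), Wm_dep r hr t.1 _ y (hu true),
    Wm_dep r hr t.1 _ y (hu false), hr t _ y (hu true), hr t _ y (hu false)]
  cases Y y <;> simp [sgn] <;> ring

lemma labels_dep {n : ℕ} {X : Type*}
    (g : (t : Fin n) → (Fin t.1 → X) → (Fin t.1 → Bool) → (Fin t.1 → Bool) → X → Bool)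
    (x x' : Fin n → X) (yh yh' : Fin n → Bool) (m : ℕ) : ∀ t : Fin n, t.1 = m →
    (∀ s : Fin n, s.1 ≤ t.1 → x s = x' s) → (∀ s : Fin n, s.1 < t.1 → yh s = yh' s) →
    labels g x yh t = labels g x' yh' t := by
  induction m using Nat.strong_induction_on with
  | _ m ih =>
    intro t ht hx hy
    rw [labels, labels]
    have e1 : (fun s : Fin t.1 => x ⟨s.1, s.2.trans t.2⟩) = fun s => x' ⟨s.1, s.2.trans t.2⟩ := by
      funext s; exact hx _ s.2.le
    have e2 : (fun s : Fin t.1 => yh ⟨s.1, s.2.trans t.2⟩)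
        = fun s => yh' ⟨s.1, s.2.trans t.2⟩ := by
      funext s; exact hy _ s.2
    have e3 : (fun s : Fin t.1 => labels g x yh ⟨s.1, s.2.trans t.2⟩)
        = fun s => labels g x' yh' ⟨s.1, s.2.trans t.2⟩ := by
      funext s
      exact ih s.1 (ht ▸ s.2) _ rfl (fun u hu => hx u (hu.trans s.2.le))
        (fun u hu => hy u (hu.trans s.2))
    rw [e1, e2, e3, hx t le_rfl]

/-- The mean of the prediction as a function of `x` and `yh`. -/
def rr {n : ℕ} {X : Type*}
    (q : (t : Fin n) → (Fin (t.1 + 1) → X) → (Fin t.1 → Bool) → ℝ)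
    (g : (t : Fin n) → (Fin t.1 → X) → (Fin t.1 → Bool) → (Fin t.1 → Bool) → X → Bool)
    (x : Fin n → X) (t : Fin n) (yh : Fin n → Bool) : ℝ :=
  q t (fun s => x (Fin.castLE t.isLt s)) (fun s => labels g x yh ⟨s.1, s.2.trans t.2⟩)

lemma coinWeight_eq {n : ℕ} {X : Type*}
    (q : (t : Fin n) → (Fin (t.1 + 1) → X) → (Fin t.1 → Bool) → ℝ)
    (g : (t : Fin n) → (Fin t.1 → X) → (Fin t.1 → Bool) → (Fin t.1 → Bool) → X → Bool)
    (x : Fin n → X) (yh : Fin n → Bool) : coinWeight q g x yh = Wm (rr q g x) n yh := by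
  unfold coinWeight Wm rr
  exact Finset.prod_congr rfl fun s _ => by simp [s.2]

lemma rr_dep {n : ℕ} {X : Type*}
    (q : (t : Fin n) → (Fin (t.1 + 1) → X) → (Fin t.1 → Bool) → ℝ)
    (g : (t : Fin n) → (Fin t.1 → X) → (Fin t.1 → Bool) → (Fin t.1 → Bool) → X → Bool)
    (x x' : Fin n → X) (yh yh' : Fin n → Bool) (t : Fin n)
    (hx : ∀ s : Fin n, s.1 ≤ t.1 → x s = x' s) (hy : ∀ s : Fin n, s.1 < t.1 → yh s = yh' s) :
    rr q g x t yh = rr q g x' t yh' := by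
  unfold rr
  congr 1
  · funext s; exact hx _ (by have := s.2; simp; omega)
  · funext s
    exact labels_dep g x x' yh yh' _ _ rfl (fun u hu => hx u (hu.trans s.2.le))
      (fun u hu => hy u (hu.trans s.2))

lemma mistakes_eq {n : ℕ} {X : Type*}
    (q : (t : Fin n) → (Fin (t.1 + 1) → X) → (Fin t.1 → Bool) → ℝ)
    (g : (t : Fin n) → (Fin t.1 → X) → (Fin t.1 → Bool) → (Fin t.1 → Bool) → X → Bool)
    (x : Fin n → X) :
    ∑ yh : Fin n → Bool, coinWeight q g x yh *
        ((1 / n) * ∑ t : Fin n, if yh t ≠ labels g x yh t then (1 : ℝ) else 0)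
    = (1 / n) * ∑ t : Fin n,
        (1 / 2 - (∑ yh, coinWeight q g x yh * (sgn (labels g x yh t) * rr q g x t yh)) / 2) := by
  have h : ∀ t : Fin n, (1 / 2 - (∑ yh, coinWeight q g x yh *
        (sgn (labels g x yh t) * rr q g x t yh)) / 2)
      = ∑ yh, coinWeight q g x yh * (if yh t ≠ labels g x yh t then (1 : ℝ) else 0) := by
    intro t
    simp only [coinWeight_eq]
    refine (Wm_mistake (rr q g x) (fun s a b h => rr_dep q g x x a b s (fun _ _ => rfl) h) t
      (fun yh => labels g x yh t) fun a b h => ?_).symm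
    exact labels_dep g x x a b _ t rfl (fun _ _ => rfl) h
  simp only [h]
  rw [Finset.sum_comm, Finset.mul_sum]
  refine Finset.sum_congr rfl fun y _ => ?_
  rw [← Finset.mul_sum]; ring

lemma coinWeight_const {n : ℕ} {X : Type*}
    (q : (t : Fin n) → (Fin (t.1 + 1) → X) → (Fin t.1 → Bool) → ℝ)
    (g : (t : Fin n) → (Fin t.1 → X) → (Fin t.1 → Bool) → (Fin t.1 → Bool) → X → Bool)
    (x : Fin n → X) (c : ℝ) : ∑ yh, coinWeight q g x yh * c = c := by
  simp only [coinWeight_eq]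
  exact Wm_const _ (fun s a b h => rr_dep q g x x a b s (fun _ _ => rfl) h) c

/-- Half the discrete derivative of the averaged `φ`. -/
def Dd {n : ℕ} {X : Type*} (φ : (Fin n → X) → (Fin n → Bool) → ℝ) (t : Fin n)
    (z : Fin n → X) (y : Fin n → Bool) : ℝ :=
  (∑ ε : Fin n → Bool, (φ z (Function.update (spl t.1 y ε) t true)
    - φ z (Function.update (spl t.1 y ε) t false))) / 2 ^ n / 2

lemma Dd_dep {n : ℕ} {X : Type*} (φ : (Fin n → X) → (Fin n → Bool) → ℝ) (t : Fin n)
    (z : Fin n → X) : Dep t.1 (Dd φ t z) := by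
  intro a b h
  have : ∀ ε, spl t.1 a ε = spl t.1 b ε := by
    intro ε; funext s; unfold spl; split_ifs with hs
    · exact h s hs
    · rfl
  simp only [Dd, this]

/-- The partially averaged `φ`. -/
def Cc {n : ℕ} {X : Type*} (φ : (Fin n → X) → (Fin n → Bool) → ℝ) (m : ℕ)
    (z : Fin n → X) (y : Fin n → Bool) : ℝ :=
  (∑ ε : Fin n → Bool, φ z (spl m y ε)) / 2 ^ n

lemma Cc_step {n : ℕ} {X : Type*} (φ : (Fin n → X) → (Fin n → Bool) → ℝ) (t : Fin n)
    (z : Fin n → X) (y : Fin n → Bool) :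
    Cc φ (t.1 + 1) z y - Cc φ t.1 z y = sgn (y t) * Dd φ t z y := by
  have e1 : ∀ ε, spl (t.1 + 1) y ε = Function.update (spl t.1 y ε) t (y t) := by
    intro ε; funext s
    by_cases hs : s = t
    · subst hs; simp [spl]
    · have h2 : s.1 ≠ t.1 := fun h => hs (Fin.ext h)
      have : s.1 < t.1 + 1 ↔ s.1 < t.1 := by omega
      simp [spl, hs, this]
  have e2 : ∀ ε b, spl t.1 y (Function.update ε t b) = Function.update (spl t.1 y ε) t b := by
    intro ε b; funext s
    by_cases hs : s = t
    · subst hs; simp [spl]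
    · simp [spl, hs]
  unfold Cc Dd
  rw [sum_flip_avg t (fun ε => φ z (spl t.1 y ε))]
  simp only [e1, e2]
  rw [← sub_div, ← Finset.sum_sub_distrib, div_right_comm, mul_div_assoc']
  congr 1
  rw [Finset.sum_div, Finset.mul_sum]
  refine Finset.sum_congr rfl fun ε _ => ?_
  cases y t <;> simp [sgn] <;> ring

lemma Cc_tele {n : ℕ} {X : Type*} (φ : (Fin n → X) → (Fin n → Bool) → ℝ)
    (z : Fin n → X) (y : Fin n → Bool) :
    φ z y = (∑ ε : Fin n → Bool, φ z ε) / 2 ^ n + ∑ t : Fin n, sgn (y t) * Dd φ t z y := by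
  have h0 : Cc φ 0 z y = (∑ ε : Fin n → Bool, φ z ε) / 2 ^ n := by
    have : ∀ ε, spl 0 y ε = ε := fun ε => by funext s; simp [spl]
    simp only [Cc, this]
  have hn : Cc φ n z y = φ z y := by
    have : ∀ ε, spl n y ε = y := fun ε => by funext s; simp [spl]
    simp [Cc, this]
  have : ∑ t : Fin n, sgn (y t) * Dd φ t z y = Cc φ n z y - Cc φ 0 z y := by
    rw [← Finset.sum_range_sub (fun m => Cc φ m z y) n, Finset.sum_range]
    exact Finset.sum_congr rfl fun t _ => (Cc_step φ t z y).symm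
  rw [this, h0, hn]; ring

section meas
variable {n : ℕ} {X : Type} [MeasurableSpace X]

lemma meas_fin {Z ι β : Type*} [MeasurableSpace Z] [MeasurableSpace β] [MeasurableSpace ι]
    [Countable ι] [MeasurableSingletonClass ι] (f : Z → ι → β)
    (hf : ∀ i, Measurable fun z => f z i) (k : Z → ι) (hk : Measurable k) :
    Measurable fun z => f z (k z) := by
  have : Measurable fun p : Z × ι => f p.1 p.2 := measurable_from_prod_countable_left hf
  exact this.comp (measurable_id.prodMk hk)

lemma labels_meas
    (g : (t : Fin n) → (Fin t.1 → X) → (Fin t.1 → Bool) → (Fin t.1 → Bool) → X → Bool)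
    (hg : ∀ (t : Fin n) (yp yhp : Fin t.1 → Bool),
          Measurable fun p : (Fin t.1 → X) × X => g t p.1 yp yhp p.2)
    (yh : Fin n → Bool) (m : ℕ) : ∀ t : Fin n, t.1 = m →
    Measurable fun x : Fin n → X => labels g x yh t := by
  induction m using Nat.strong_induction_on with
  | _ m ih =>
    intro t ht
    have hrw : (fun x : Fin n → X => labels g x yh t) = fun x =>
      (fun (x : Fin n → X) (l : Fin t.1 → Bool) => g t (fun s => x ⟨s.1, s.2.trans t.2⟩)
        l (fun s => yh ⟨s.1, s.2.trans t.2⟩) (x t)) x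
        (fun s => labels g x yh ⟨s.1, s.2.trans t.2⟩) := by
      funext x; rw [labels]
    rw [hrw]
    refine meas_fin (fun (x : Fin n → X) (l : Fin t.1 → Bool) =>
      g t (fun s => x ⟨s.1, s.2.trans t.2⟩)
        l (fun s => yh ⟨s.1, s.2.trans t.2⟩) (x t)) ?_ _ ?_
    · intro l
      exact (hg t l _).comp (Measurable.prodMk
        (measurable_pi_iff.2 fun s => measurable_pi_apply _) (measurable_pi_apply t))
    · exact measurable_pi_iff.2 fun s => ih s.1 (ht ▸ s.2) _ rfl

lemma rr_meas (q : (t : Fin n) → (Fin (t.1 + 1) → X) → (Fin t.1 → Bool) → ℝ)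
    (hq : ∀ (t : Fin n) (h : Fin t.1 → Bool), Measurable fun xs => q t xs h)
    (g : (t : Fin n) → (Fin t.1 → X) → (Fin t.1 → Bool) → (Fin t.1 → Bool) → X → Bool)
    (hg : ∀ (t : Fin n) (yp yhp : Fin t.1 → Bool),
          Measurable fun p : (Fin t.1 → X) × X => g t p.1 yp yhp p.2)
    (yh : Fin n → Bool) (t : Fin n) : Measurable fun x => rr q g x t yh := by
  unfold rr
  refine meas_fin (fun (x : Fin n → X) (l : Fin t.1 → Bool) =>
    q t (fun s => x (Fin.castLE t.isLt s)) l) ?_ _ ?_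
  · intro l
    exact (hq t l).comp (measurable_pi_iff.2 fun s => measurable_pi_apply _)
  · exact measurable_pi_iff.2 fun s => labels_meas g hg yh _ _ rfl

lemma Wm_meas (q : (t : Fin n) → (Fin (t.1 + 1) → X) → (Fin t.1 → Bool) → ℝ)
    (hq : ∀ (t : Fin n) (h : Fin t.1 → Bool), Measurable fun xs => q t xs h)
    (g : (t : Fin n) → (Fin t.1 → X) → (Fin t.1 → Bool) → (Fin t.1 → Bool) → X → Bool)
    (hg : ∀ (t : Fin n) (yp yhp : Fin t.1 → Bool),
          Measurable fun p : (Fin t.1 → X) × X => g t p.1 yp yhp p.2)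
    (yh : Fin n → Bool) (m : ℕ) : Measurable fun x => Wm (rr q g x) m yh := by
  unfold Wm
  refine Finset.measurable_prod _ fun s _ => ?_
  by_cases h : s.1 < m
  · simp only [h, if_true]
    exact ((((rr_meas q hq g hg yh s).const_mul _).const_add _).div_const _)
  · simp only [h, if_false]; exact measurable_const

lemma sgn_abs (b : Bool) : |sgn b| = 1 := by cases b <;> simp [sgn]

lemma Wm_bound (r : Fin n → (Fin n → Bool) → ℝ) (hr : ∀ s y, |r s y| ≤ 1) (m : ℕ)
    (yh : Fin n → Bool) : |Wm r m yh| ≤ 1 := by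
  unfold Wm
  rw [Finset.abs_prod]
  refine Finset.prod_le_one (fun _ _ => abs_nonneg _) fun s _ => ?_
  have h1 : |sgn (yh s) * r s yh| ≤ 1 := by rw [abs_mul, sgn_abs, one_mul]; exact hr s yh
  rw [abs_le] at h1 ⊢
  split_ifs <;> constructor <;> linarith [h1.1, h1.2]

lemma integrable_bdd {Z : Type*} [MeasurableSpace Z] (μ : Measure Z) [IsFiniteMeasure μ]
    (f : Z → ℝ) (hf : Measurable f) (C : ℝ) (hC : ∀ z, |f z| ≤ C) : Integrable f μ :=
  Integrable.of_bound hf.aestronglyMeasurable C (Filter.Eventually.of_forall hC)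

lemma spl_meas (m : ℕ) : Measurable fun p : (Fin n → X) × (Fin n → X) => spl m p.1 p.2 := by
  refine measurable_pi_iff.2 fun s => ?_
  unfold spl
  by_cases h : s.1 < m
  · simp only [h, if_true]; exact (measurable_pi_apply s).comp measurable_fst
  · simp only [h, if_false]; exact (measurable_pi_apply s).comp measurable_snd

lemma spl_map (P : Measure X) [IsProbabilityMeasure P] (m : ℕ) :
    ((Measure.pi fun _ : Fin n => P).prod (Measure.pi fun _ : Fin n => P)).map
      (fun p => spl m p.1 p.2) = Measure.pi fun _ : Fin n => P := by
  symm
  refine Measure.pi_eq fun s hs => ?_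
  rw [Measure.map_apply (spl_meas m) (MeasurableSet.univ_pi hs)]
  have : (fun p : (Fin n → X) × (Fin n → X) => spl m p.1 p.2) ⁻¹' Set.univ.pi s
      = (Set.univ.pi fun i : Fin n => if i.1 < m then s i else Set.univ) ×ˢ
        (Set.univ.pi fun i : Fin n => if i.1 < m then Set.univ else s i) := by
    ext p
    simp only [Set.mem_preimage, Set.mem_pi, Set.mem_univ, true_imp_iff, Set.mem_prod, spl]
    rw [← forall_and]
    refine forall_congr' fun i => ?_
    split_ifs <;> simp
  rw [this, Measure.prod_prod, Measure.pi_pi, Measure.pi_pi, ← Finset.prod_mul_distrib]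
  refine Finset.prod_congr rfl fun i _ => ?_
  split_ifs <;> simp

lemma integral_spl (P : Measure X) [IsProbabilityMeasure P] (m : ℕ) (f : (Fin n → X) → ℝ)
    (hf : Measurable f) (C : ℝ) (hC : ∀ z, |f z| ≤ C) :
    ∫ x, (∫ x', f (spl m x x') ∂(Measure.pi fun _ : Fin n => P)) ∂(Measure.pi fun _ : Fin n => P)
      = ∫ x, f x ∂(Measure.pi fun _ : Fin n => P) := by
  conv_rhs => rw [← spl_map P m]
  rw [integral_map (spl_meas m).aemeasurable hf.aestronglyMeasurable, integral_prod]
  exact integrable_bdd _ _ (hf.comp (spl_meas m)) C fun z => hC _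

/-- The extension of an initial segment of side information. -/
def extx (t : Fin n) (xs : Fin (t.1 + 1) → X) (x' : Fin n → X) : Fin n → X :=
  fun s => if h : s.1 < t.1 + 1 then xs ⟨s.1, h⟩ else x' s

/-- The extension of an initial segment of labels. -/
def exty (t : Fin n) (h : Fin t.1 → Bool) : Fin n → Bool :=
  fun s => if hs : s.1 < t.1 then h ⟨s.1, hs⟩ else false

/-- The forecaster's strategy. -/
def qq (P : Measure X) (φ : (Fin n → X) → (Fin n → Bool) → ℝ) (t : Fin n)
    (xs : Fin (t.1 + 1) → X) (h : Fin t.1 → Bool) : ℝ :=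
  ∫ x', (-(2 * n : ℝ)) * Dd φ t (extx t xs x') (exty t h) ∂(Measure.pi fun _ : Fin n => P)

lemma Dd_bound (φ : (Fin n → X) → (Fin n → Bool) → ℝ)
    (hstable : ∀ (x : Fin n → X) (y : Fin n → Bool) (t : Fin n),
      |φ x (Function.update y t true) - φ x (Function.update y t false)| ≤ 1 / n)
    (t : Fin n) (z : Fin n → X) (y : Fin n → Bool) : |Dd φ t z y| ≤ 1 / n / 2 := by
  unfold Dd
  rw [abs_div, abs_div, abs_of_pos (by positivity : (0 : ℝ) < 2 ^ n), abs_two]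
  refine div_le_div_of_nonneg_right ?_ (by norm_num)
  rw [div_le_iff₀ (by positivity)]
  refine (Finset.abs_sum_le_sum_abs _ _).trans ?_
  refine (Finset.sum_le_sum fun ε _ => hstable z (spl t.1 y ε) t).trans ?_
  simp [mul_comm]

lemma Dd_meas (φ : (Fin n → X) → (Fin n → Bool) → ℝ)
    (hmeas : ∀ y : Fin n → Bool, Measurable fun x => φ x y) (t : Fin n) (y : Fin n → Bool) :
    Measurable fun z => Dd φ t z y := by
  unfold Dd
  exact ((Finset.measurable_sum _ fun ε _ => (hmeas _).sub (hmeas _)).div_const _).div_const _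

lemma two_n_bound (hn : 1 ≤ n) (d : ℝ) (hd : |d| ≤ 1 / n / 2) : |(-(2 * n : ℝ)) * d| ≤ 1 := by
  have hn' : (0 : ℝ) < n := by exact_mod_cast hn
  rw [abs_mul, abs_neg, abs_of_pos (by positivity : (0 : ℝ) < 2 * n)]
  calc (2 * n : ℝ) * |d| ≤ 2 * n * (1 / n / 2) := by gcongr
    _ = 1 := by field_simp

lemma qq_bound (hn : 1 ≤ n) (P : Measure X) [IsProbabilityMeasure P]
    (φ : (Fin n → X) → (Fin n → Bool) → ℝ)
    (hstable : ∀ (x : Fin n → X) (y : Fin n → Bool) (t : Fin n),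
      |φ x (Function.update y t true) - φ x (Function.update y t false)| ≤ 1 / n)
    (t : Fin n) (xs : Fin (t.1 + 1) → X) (h : Fin t.1 → Bool) : |qq P φ t xs h| ≤ 1 := by
  unfold qq
  have := norm_integral_le_of_norm_le_const (μ := Measure.pi fun _ : Fin n => P) (C := 1)
    (f := fun x' => (-(2 * n : ℝ)) * Dd φ t (extx t xs x') (exty t h))
    (Filter.Eventually.of_forall fun x' => two_n_bound hn _ (Dd_bound φ hstable t _ _))
  simpa using this

lemma qq_meas (P : Measure X) [IsProbabilityMeasure P]
    (φ : (Fin n → X) → (Fin n → Bool) → ℝ)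
    (hmeas : ∀ y : Fin n → Bool, Measurable fun x => φ x y)
    (t : Fin n) (h : Fin t.1 → Bool) : Measurable fun xs => qq P φ t xs h := by
  unfold qq
  have hext : Measurable fun p : (Fin (t.1 + 1) → X) × (Fin n → X) => extx t p.1 p.2 := by
    refine measurable_pi_iff.2 fun s => ?_
    unfold extx
    by_cases h : s.1 < t.1 + 1
    · simp only [h, dif_pos]; exact (measurable_pi_apply _).comp measurable_fst
    · simp only [h, dif_neg, not_false_eq_true]; exact (measurable_pi_apply s).comp measurable_snd
  have hm : Measurable fun p : (Fin (t.1 + 1) → X) × (Fin n → X) =>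
      (-(2 * n : ℝ)) * Dd φ t (extx t p.1 p.2) (exty t h) :=
    ((Dd_meas φ hmeas t _).comp hext).const_mul _
  exact (hm.stronglyMeasurable.integral_prod_right).measurable

lemma rr_qq (P : Measure X) [IsProbabilityMeasure P]
    (φ : (Fin n → X) → (Fin n → Bool) → ℝ)
    (g : (t : Fin n) → (Fin t.1 → X) → (Fin t.1 → Bool) → (Fin t.1 → Bool) → X → Bool)
    (x : Fin n → X) (t : Fin n) (yh : Fin n → Bool) :
    rr (qq P φ) g x t yh = (-(2 * n : ℝ)) *
      ∫ x', Dd φ t (spl (t.1 + 1) x x') (labels g x yh) ∂(Measure.pi fun _ : Fin n => P) := by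
  unfold rr qq
  rw [integral_const_mul]
  congr 2
  funext x'
  have h1 : extx t (fun s => x (Fin.castLE t.isLt s)) x' = spl (t.1 + 1) x x' := by
    funext s
    unfold extx spl
    split_ifs <;> rfl
  rw [h1]
  refine Dd_dep φ t _ _ _ fun s hs => ?_
  simp [exty, hs]

/-- Replacing the derivative by its conditional mean. -/
lemma key_exchange (P : Measure X) [IsProbabilityMeasure P]
    (φ : (Fin n → X) → (Fin n → Bool) → ℝ)
    (hmeas : ∀ y : Fin n → Bool, Measurable fun x => φ x y)
    (hstable : ∀ (x : Fin n → X) (y : Fin n → Bool) (t : Fin n),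
      |φ x (Function.update y t true) - φ x (Function.update y t false)| ≤ 1 / n)
    (q : (t : Fin n) → (Fin (t.1 + 1) → X) → (Fin t.1 → Bool) → ℝ)
    (hqb : ∀ (t : Fin n) (xs : Fin (t.1 + 1) → X) (h : Fin t.1 → Bool), |q t xs h| ≤ 1)
    (hq : ∀ (t : Fin n) (h : Fin t.1 → Bool), Measurable fun xs => q t xs h)
    (g : (t : Fin n) → (Fin t.1 → X) → (Fin t.1 → Bool) → (Fin t.1 → Bool) → X → Bool)
    (hg : ∀ (t : Fin n) (yp yhp : Fin t.1 → Bool),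
          Measurable fun p : (Fin t.1 → X) × X => g t p.1 yp yhp p.2)
    (t : Fin n) (yh : Fin n → Bool) :
    ∫ x, Wm (rr q g x) t.1 yh * (sgn (labels g x yh t) * Dd φ t x (labels g x yh))
        ∂(Measure.pi fun _ : Fin n => P)
    = ∫ x, Wm (rr q g x) t.1 yh * (sgn (labels g x yh t) *
        ∫ x', Dd φ t (spl (t.1 + 1) x x') (labels g x yh) ∂(Measure.pi fun _ : Fin n => P))
        ∂(Measure.pi fun _ : Fin n => P) := by
  have hlm : Measurable fun x : Fin n → X => labels g x yh :=
    measurable_pi_iff.2 fun s => labels_meas g hg yh _ s rfl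
  rw [← integral_spl P (t.1 + 1) _ _ (1 * (1 * (1 / n / 2)))]
  · congr 1
    funext x
    rw [← integral_const_mul, ← integral_const_mul]
    congr 1
    funext x'
    have hx : ∀ s : Fin n, s.1 ≤ t.1 → spl (t.1 + 1) x x' s = x s := by
      intro s hs; simp [spl, Nat.lt_succ_of_le hs]
    have hl : ∀ s : Fin n, s.1 ≤ t.1 →
        labels g (spl (t.1 + 1) x x') yh s = labels g x yh s := fun s hs =>
      labels_dep g _ _ yh yh _ s rfl (fun u hu => hx u (hu.trans hs)) fun _ _ => rfl
    rw [hl t le_rfl, Dd_dep φ t _ _ (labels g x yh) fun s hs => hl s hs.le]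
    congr 1
    unfold Wm
    refine Finset.prod_congr rfl fun s _ => ?_
    by_cases hs : s.1 < t.1
    · rw [rr_dep q g (spl (t.1 + 1) x x') x yh yh s (fun u hu => hx u (hu.trans hs.le))
        fun _ _ => rfl]
    · simp [hs]
  · intro x
    rw [abs_mul, abs_mul, sgn_abs]
    have h1 := Wm_bound (rr q g x) (fun s y => hqb _ _ _) t.1 yh
    have h2 := Dd_bound φ hstable t x (labels g x yh)
    gcongr
  · refine (Wm_meas q hq g hg yh _).mul (Measurable.mul ?_ ?_)
    · exact (measurable_of_finite sgn).comp (labels_meas g hg yh _ t rfl)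
    · exact meas_fin (fun x l => Dd φ t x l) (fun l => Dd_meas φ hmeas t l) _ hlm

lemma integrable_rr (P : Measure X) [IsProbabilityMeasure P]
    (q : (t : Fin n) → (Fin (t.1 + 1) → X) → (Fin t.1 → Bool) → ℝ)
    (hqb : ∀ (t : Fin n) (xs : Fin (t.1 + 1) → X) (h : Fin t.1 → Bool), |q t xs h| ≤ 1)
    (hq : ∀ (t : Fin n) (h : Fin t.1 → Bool), Measurable fun xs => q t xs h)
    (g : (t : Fin n) → (Fin t.1 → X) → (Fin t.1 → Bool) → (Fin t.1 → Bool) → X → Bool)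
    (hg : ∀ (t : Fin n) (yp yhp : Fin t.1 → Bool),
          Measurable fun p : (Fin t.1 → X) × X => g t p.1 yp yhp p.2)
    (t : Fin n) (m : ℕ) (yh : Fin n → Bool) :
    Integrable (fun x => Wm (rr q g x) m yh * (sgn (labels g x yh t) * rr q g x t yh))
      (Measure.pi fun _ : Fin n => P) := by
  refine integrable_bdd _ _ ?_ (1 * (1 * 1)) ?_
  · exact (Wm_meas q hq g hg yh _).mul (Measurable.mul
      ((measurable_of_finite sgn).comp (labels_meas g hg yh _ t rfl)) (rr_meas q hq g hg yh t))
  · intro x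
    rw [abs_mul, abs_mul, sgn_abs]
    have h1 := Wm_bound (rr q g x) (fun s y => hqb _ _ _) m yh
    have h2 : |rr q g x t yh| ≤ 1 := hqb _ _ _
    gcongr

lemma integrable_Dd (P : Measure X) [IsProbabilityMeasure P]
    (φ : (Fin n → X) → (Fin n → Bool) → ℝ)
    (hmeas : ∀ y : Fin n → Bool, Measurable fun x => φ x y)
    (hstable : ∀ (x : Fin n → X) (y : Fin n → Bool) (t : Fin n),
      |φ x (Function.update y t true) - φ x (Function.update y t false)| ≤ 1 / n)
    (q : (t : Fin n) → (Fin (t.1 + 1) → X) → (Fin t.1 → Bool) → ℝ)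
    (hqb : ∀ (t : Fin n) (xs : Fin (t.1 + 1) → X) (h : Fin t.1 → Bool), |q t xs h| ≤ 1)
    (hq : ∀ (t : Fin n) (h : Fin t.1 → Bool), Measurable fun xs => q t xs h)
    (g : (t : Fin n) → (Fin t.1 → X) → (Fin t.1 → Bool) → (Fin t.1 → Bool) → X → Bool)
    (hg : ∀ (t : Fin n) (yp yhp : Fin t.1 → Bool),
          Measurable fun p : (Fin t.1 → X) × X => g t p.1 yp yhp p.2)
    (t : Fin n) (m : ℕ) (yh : Fin n → Bool) :
    Integrable (fun x => Wm (rr q g x) m yh *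
      (sgn (labels g x yh t) * Dd φ t x (labels g x yh))) (Measure.pi fun _ : Fin n => P) := by
  have hlm : Measurable fun x : Fin n → X => labels g x yh :=
    measurable_pi_iff.2 fun s => labels_meas g hg yh _ s rfl
  refine integrable_bdd _ _ ?_ (1 * (1 * (1 / n / 2))) ?_
  · exact (Wm_meas q hq g hg yh _).mul (Measurable.mul
      ((measurable_of_finite sgn).comp (labels_meas g hg yh _ t rfl))
      (meas_fin (fun x l => Dd φ t x l) (fun l => Dd_meas φ hmeas t l) _ hlm))
  · intro x
    rw [abs_mul, abs_mul, sgn_abs]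
    have h1 := Wm_bound (rr q g x) (fun s y => hqb _ _ _) m yh
    have h2 := Dd_bound φ hstable t x (labels g x yh)
    gcongr

lemma exch (hn : 1 ≤ n) (P : Measure X) [IsProbabilityMeasure P]
    (φ : (Fin n → X) → (Fin n → Bool) → ℝ)
    (hmeas : ∀ y : Fin n → Bool, Measurable fun x => φ x y)
    (hstable : ∀ (x : Fin n → X) (y : Fin n → Bool) (t : Fin n),
      |φ x (Function.update y t true) - φ x (Function.update y t false)| ≤ 1 / n)
    (g : (t : Fin n) → (Fin t.1 → X) → (Fin t.1 → Bool) → (Fin t.1 → Bool) → X → Bool)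
    (hg : ∀ (t : Fin n) (yp yhp : Fin t.1 → Bool),
          Measurable fun p : (Fin t.1 → X) × X => g t p.1 yp yhp p.2)
    (t : Fin n) :
    ∫ x, ∑ yh, coinWeight (qq P φ) g x yh * (sgn (labels g x yh t) * rr (qq P φ) g x t yh)
        ∂(Measure.pi fun _ : Fin n => P)
    = (-(2 * n : ℝ)) * ∫ x, ∑ yh, coinWeight (qq P φ) g x yh *
        (sgn (labels g x yh t) * Dd φ t x (labels g x yh)) ∂(Measure.pi fun _ : Fin n => P) := by
  have hqb := qq_bound hn P φ hstable
  have hq := qq_meas P φ hmeas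
  have hlab : ∀ x : Fin n → X, ∀ a b : Fin n → Bool, (∀ s : Fin n, s.1 < t.1 → a s = b s) →
      ∀ u : Fin n, u.1 ≤ t.1 → labels g x a u = labels g x b u := fun x a b h u hu =>
    labels_dep g x x a b _ u rfl (fun _ _ => rfl) fun s hs => h s (hs.trans_le hu)
  have hrd : ∀ x : Fin n → X, ∀ s : Fin n, Dep s.1 (rr (qq P φ) g x s) := fun x s a b h =>
    rr_dep (qq P φ) g x x a b s (fun _ _ => rfl) h
  have e1 : ∀ x, ∑ yh, coinWeight (qq P φ) g x yh *
        (sgn (labels g x yh t) * rr (qq P φ) g x t yh)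
      = ∑ yh, Wm (rr (qq P φ) g x) t.1 yh *
        (sgn (labels g x yh t) * rr (qq P φ) g x t yh) := by
    intro x
    simp only [coinWeight_eq]
    exact Wm_full _ (hrd x) t.1 t.2.le _ fun a b h => by
      rw [hlab x a b h t le_rfl, hrd x t a b h]
  have e2 : ∀ x, ∑ yh, coinWeight (qq P φ) g x yh *
        (sgn (labels g x yh t) * Dd φ t x (labels g x yh))
      = ∑ yh, Wm (rr (qq P φ) g x) t.1 yh *
        (sgn (labels g x yh t) * Dd φ t x (labels g x yh)) := by
    intro x
    simp only [coinWeight_eq]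
    exact Wm_full _ (hrd x) t.1 t.2.le _ fun a b h => by
      rw [hlab x a b h t le_rfl, Dd_dep φ t x _ _ fun s hs => hlab x a b h s hs.le]
  simp only [e1, e2]
  rw [integral_finsetSum _ fun yh _ => integrable_rr P _ hqb hq g hg t t.1 yh,
    integral_finsetSum _ fun yh _ =>
      integrable_Dd P φ hmeas hstable _ hqb hq g hg t t.1 yh, Finset.mul_sum]
  refine Finset.sum_congr rfl fun yh _ => ?_
  rw [key_exchange P φ hmeas hstable _ hqb hq g hg t yh, ← integral_const_mul]
  congr 1
  funext x
  rw [rr_qq P φ g x t yh]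
  ring

lemma integral_mistakes (hn : 1 ≤ n) (P : Measure X) [IsProbabilityMeasure P]
    (q : (t : Fin n) → (Fin (t.1 + 1) → X) → (Fin t.1 → Bool) → ℝ)
    (hqb : ∀ (t : Fin n) (xs : Fin (t.1 + 1) → X) (h : Fin t.1 → Bool), |q t xs h| ≤ 1)
    (hq : ∀ (t : Fin n) (h : Fin t.1 → Bool), Measurable fun xs => q t xs h)
    (g : (t : Fin n) → (Fin t.1 → X) → (Fin t.1 → Bool) → (Fin t.1 → Bool) → X → Bool)
    (hg : ∀ (t : Fin n) (yp yhp : Fin t.1 → Bool),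
          Measurable fun p : (Fin t.1 → X) × X => g t p.1 yp yhp p.2) :
    (∫ x, ∑ yh : Fin n → Bool,
            coinWeight q g x yh *
              ((1 / n) * ∑ t : Fin n, if yh t ≠ labels g x yh t then (1 : ℝ) else 0)
          ∂(Measure.pi fun _ : Fin n => P))
    = 1 / 2 - (1 / n) / 2 * ∑ t : Fin n, ∫ x, ∑ yh, coinWeight q g x yh *
        (sgn (labels g x yh t) * rr q g x t yh) ∂(Measure.pi fun _ : Fin n => P) := by
  have hn' : (n : ℝ) ≠ 0 := by positivity
  have hInt : ∀ t : Fin n, Integrable (fun x => ∑ yh, coinWeight q g x yh *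
        (sgn (labels g x yh t) * rr q g x t yh)) (Measure.pi fun _ : Fin n => P) := by
    intro t
    simp only [coinWeight_eq]
    exact integrable_finsetSum _ fun yh _ => integrable_rr P q hqb hq g hg t n yh
  simp only [mistakes_eq]
  have hInt2 : ∀ t : Fin n, Integrable (fun x => (1 / 2 - (∑ yh, coinWeight q g x yh *
        (sgn (labels g x yh t) * rr q g x t yh)) / 2)) (Measure.pi fun _ : Fin n => P) := fun t =>
    (integrable_const _).sub ((hInt t).div_const 2)
  rw [integral_const_mul, integral_finsetSum _ fun t _ => hInt2 t]
  have : ∀ t : Fin n, ∫ x, (1 / 2 - (∑ yh, coinWeight q g x yh *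
        (sgn (labels g x yh t) * rr q g x t yh)) / 2) ∂(Measure.pi fun _ : Fin n => P)
      = 1 / 2 - (∫ x, ∑ yh, coinWeight q g x yh *
        (sgn (labels g x yh t) * rr q g x t yh) ∂(Measure.pi fun _ : Fin n => P)) / 2 := by
    intro t
    rw [integral_sub (integrable_const _) ((hInt t).div_const 2)]
    simp
    exact integral_div _ _
  simp only [this]
  rw [Finset.sum_sub_distrib]
  simp
  field_simp
  rw [← Finset.sum_div]
  ring

lemma integral_phi (hn : 1 ≤ n) (P : Measure X) [IsProbabilityMeasure P]
    (φ : (Fin n → X) → (Fin n → Bool) → ℝ)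
    (hmeas : ∀ y : Fin n → Bool, Measurable fun x => φ x y)
    (hbdd : ∃ C : ℝ, ∀ (x : Fin n → X) (y : Fin n → Bool), |φ x y| ≤ C)
    (hstable : ∀ (x : Fin n → X) (y : Fin n → Bool) (t : Fin n),
      |φ x (Function.update y t true) - φ x (Function.update y t false)| ≤ 1 / n)
    (q : (t : Fin n) → (Fin (t.1 + 1) → X) → (Fin t.1 → Bool) → ℝ)
    (hqb : ∀ (t : Fin n) (xs : Fin (t.1 + 1) → X) (h : Fin t.1 → Bool), |q t xs h| ≤ 1)
    (hq : ∀ (t : Fin n) (h : Fin t.1 → Bool), Measurable fun xs => q t xs h)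
    (g : (t : Fin n) → (Fin t.1 → X) → (Fin t.1 → Bool) → (Fin t.1 → Bool) → X → Bool)
    (hg : ∀ (t : Fin n) (yp yhp : Fin t.1 → Bool),
          Measurable fun p : (Fin t.1 → X) × X => g t p.1 yp yhp p.2) :
    ∫ x, ∑ yh : Fin n → Bool, coinWeight q g x yh * φ x (labels g x yh)
          ∂(Measure.pi fun _ : Fin n => P)
    = (∑ ε : Fin n → Bool, ∫ x, φ x ε ∂(Measure.pi fun _ : Fin n => P)) / 2 ^ n
      + ∑ t : Fin n, ∫ x, ∑ yh, coinWeight q g x yh *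
        (sgn (labels g x yh t) * Dd φ t x (labels g x yh)) ∂(Measure.pi fun _ : Fin n => P) := by
  obtain ⟨C, hC⟩ := hbdd
  have hφ : ∀ ε, Integrable (fun x => φ x ε) (Measure.pi fun _ : Fin n => P) := fun ε =>
    integrable_bdd _ _ (hmeas ε) C fun x => hC x ε
  have hInt : ∀ t : Fin n, Integrable (fun x => ∑ yh, coinWeight q g x yh *
        (sgn (labels g x yh t) * Dd φ t x (labels g x yh))) (Measure.pi fun _ : Fin n => P) := by
    intro t
    simp only [coinWeight_eq]
    exact integrable_finsetSum _ fun yh _ =>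
      integrable_Dd P φ hmeas hstable q hqb hq g hg t n yh
  have e : ∀ x, ∑ yh : Fin n → Bool, coinWeight q g x yh * φ x (labels g x yh)
      = (∑ ε : Fin n → Bool, φ x ε) / 2 ^ n + ∑ t : Fin n, ∑ yh, coinWeight q g x yh *
        (sgn (labels g x yh t) * Dd φ t x (labels g x yh)) := by
    intro x
    rw [Finset.sum_comm]
    conv_rhs => rw [← coinWeight_const q g x ((∑ ε : Fin n → Bool, φ x ε) / 2 ^ n)]
    rw [← Finset.sum_add_distrib]
    refine Finset.sum_congr rfl fun yh _ => ?_
    rw [← Finset.mul_sum, ← mul_add, ← Cc_tele]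
  simp only [e]
  rw [integral_add ((integrable_finsetSum _ fun ε _ => hφ ε).div_const _)
    (integrable_finsetSum _ fun t _ => hInt t), integral_div,
    integral_finsetSum _ fun ε _ => hφ ε, integral_finsetSum _ fun t _ => hInt t]

lemma labels_const {n : ℕ} {X : Type*} (ε : Fin n → Bool) (x : Fin n → X) (yh : Fin n → Bool) :
    labels (fun t _ _ _ _ => ε t) x yh = ε := by
  funext t; rw [labels]

end meas

end helpers

/-- i.i.d. side information, adaptive Nature: for `φ` bounded, measurable in `x`
and stable in `y`, one has `E_{x,ε} φ(x;ε) ≥ 1/2` iff there is a measurable strategy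
`q_t : X^t × {±1}^{t−1} → [−1,1]` such that for every measurable adaptive Nature `g` (choosing
`y_t` from the history `(x_s,y_s,ŷ_s)_{s<t}` and `x_t`), the expected proportion of mistakes is
at most `E[φ(x_{1:n}; y_{1:n})]`, both expectations being over `x ∼ P^n` and the forecaster's
internal coins. -/
theorem prediction_iid_adaptive_nature (n : ℕ) (hn : 1 ≤ n)
    {X : Type} [MeasurableSpace X] (P : Measure X) [IsProbabilityMeasure P]
    (φ : (Fin n → X) → (Fin n → Bool) → ℝ)
    (hmeas : ∀ y : Fin n → Bool, Measurable fun x => φ x y)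
    (hbdd : ∃ C : ℝ, ∀ (x : Fin n → X) (y : Fin n → Bool), |φ x y| ≤ C)
    (hstable : ∀ (x : Fin n → X) (y : Fin n → Bool) (t : Fin n),
      |φ x (Function.update y t true) - φ x (Function.update y t false)| ≤ 1 / n) :
    1 / 2 ≤ (∑ ε : Fin n → Bool, ∫ x, φ x ε ∂(Measure.pi fun _ : Fin n => P)) / 2 ^ n ↔
    (∃ q : (t : Fin n) → (Fin (t.1 + 1) → X) → (Fin t.1 → Bool) → ℝ,
      (∀ (t : Fin n) (xs : Fin (t.1 + 1) → X) (h : Fin t.1 → Bool), |q t xs h| ≤ 1) ∧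
      (∀ (t : Fin n) (h : Fin t.1 → Bool), Measurable fun xs => q t xs h) ∧
      ∀ g : (t : Fin n) → (Fin t.1 → X) → (Fin t.1 → Bool) → (Fin t.1 → Bool) → X → Bool,
        (∀ (t : Fin n) (yp yhp : Fin t.1 → Bool),
          Measurable fun p : (Fin t.1 → X) × X => g t p.1 yp yhp p.2) →
        (∫ x, ∑ yh : Fin n → Bool,
            coinWeight q g x yh *
              ((1 / n) * ∑ t : Fin n, if yh t ≠ labels g x yh t then (1 : ℝ) else 0)
          ∂(Measure.pi fun _ : Fin n => P)) ≤
        ∫ x, ∑ yh : Fin n → Bool, coinWeight q g x yh * φ x (labels g x yh)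
          ∂(Measure.pi fun _ : Fin n => P)) := by
  have hn' : (0 : ℝ) < n := by exact_mod_cast hn
  constructor
  · intro h
    refine ⟨qq P φ, qq_bound hn P φ hstable, qq_meas P φ hmeas, fun g hg => ?_⟩
    have hqb := qq_bound hn P φ hstable
    have hq := qq_meas P φ hmeas
    rw [integral_mistakes hn P _ hqb hq g hg,
      integral_phi hn P φ hmeas hbdd hstable _ hqb hq g hg]
    simp only [exch hn P φ hmeas hstable g hg]
    rw [← Finset.mul_sum, ← mul_assoc]
    have : (1 : ℝ) / n / 2 * (-(2 * n)) = -1 := by field_simp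
    rw [this]
    linarith
  · rintro ⟨q, hqb, hq, H⟩
    have hg : ∀ ε : Fin n → Bool, ∀ (t : Fin n) (yp yhp : Fin t.1 → Bool),
          Measurable fun p : (Fin t.1 → X) × X =>
            (fun (t : Fin n) (_ : Fin t.1 → X) (_ _ : Fin t.1 → Bool) (_ : X) => ε t)
              t p.1 yp yhp p.2 := fun ε t yp yhp => measurable_const
    have H1 := fun ε : Fin n → Bool =>
      integral_mistakes hn P q hqb hq (fun t _ _ _ _ => ε t) (hg ε)
    have H2 := fun ε : Fin n → Bool =>
      (H1 ε).symm.le.trans (H (fun t _ _ _ _ => ε t) (hg ε))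
    simp only [labels_const, coinWeight_const, rr] at H2
    have H3 := Finset.sum_le_sum fun (ε : Fin n → Bool) (_ : ε ∈ Finset.univ) => H2 ε
    have hz : ∑ ε : Fin n → Bool, ∑ t : Fin n, ∫ x : Fin n → X, sgn (ε t) *
        q t (fun s => x (Fin.castLE t.isLt s)) (fun s => ε ⟨s.1, s.2.trans t.2⟩)
          ∂(Measure.pi fun _ : Fin n => P) = 0 := by
      rw [Finset.sum_comm]
      refine Finset.sum_eq_zero fun t _ => ?_
      rw [sum_flip_avg t]
      refine Finset.sum_eq_zero fun ε _ => ?_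
      have hu : ∀ b, (fun s : Fin t.1 => Function.update ε t b ⟨s.1, s.2.trans t.2⟩)
          = fun s => ε ⟨s.1, s.2.trans t.2⟩ := by
        intro b; funext s
        have : (⟨s.1, s.2.trans t.2⟩ : Fin n) ≠ t := fun h => by
          have := congrArg Fin.val h
          have := s.2
          simp at *
          omega
        simp [this]
      simp only [integral_const_mul, hu, Function.update_self]
      simp [sgn]
    rw [Finset.sum_sub_distrib, ← Finset.mul_sum, hz] at H3
    simp at H3
    rw [le_div_iff₀ (by positivity)]
    linarith
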